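/- Let n ≥ 1 be an integer, s ∈ (0,2), and let u : ℝⁿ → ℝ be a Schwartz function. Then for every x ∈ ℝⁿ the principal value (−Δ)^{s/2}u(x) := lim_{δ→0⁺} ∫_{{|y−x|>δ}} (u(x) − u(y)) · α_{n,s}/|x−y|^{n+s} dy exists, the function x ↦ u(x)·(−Δ)^{s/2}u(x) is integrable, and ∬_{ℝⁿ×ℝⁿ} α_{n,s} (u(x) − u(y))²/|x−y|^{n+s} dx dy = 2 ∫_{ℝⁿ} u(x) · (−Δ)^{s/2}u(x) dx. -/

import Mathlib

open MeasureTheory Real Set Filter Topology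

/-- `α_{n,s} = s 2^{s-1} Γ((n+s)/2) / (π^{n/2} Γ(1-s/2))`. -/
noncomputable def alphaConst (n : ℕ) (s : ℝ) : ℝ :=
  s * 2 ^ (s - 1) * Real.Gamma (((n : ℝ) + s) / 2) /
    (Real.pi ^ ((n : ℝ) / 2) * Real.Gamma (1 - s / 2))

section LevyKernel

/-- A Lévy kernel is integrable away from the origin. -/
lemma integrableOn_of_integrable_min_one_norm_sq_mul {E : Type*} [NormedAddCommGroup E]
    [MeasurableSpace E] [BorelSpace E] {μ : Measure E} {w : E → ℝ} (hwm : Measurable w)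
    (hw0 : ∀ h, 0 ≤ w h) (hw : Integrable (fun h => min 1 (‖h‖ ^ 2) * w h) μ)
    {δ : ℝ} (hδ : 0 < δ) : IntegrableOn w {h | δ < ‖h‖} μ := by
  have hm : 0 < min 1 (δ ^ 2) := by positivity
  refine ((hw.const_mul (min 1 (δ ^ 2))⁻¹).integrableOn).mono' hwm.aestronglyMeasurable
    ((ae_restrict_iff' (measurableSet_lt measurable_const measurable_norm)).2
      (ae_of_all _ fun h (hh : δ < ‖h‖) => ?_))
  rw [norm_of_nonneg (hw0 h), ← mul_assoc]
  refine le_mul_of_one_le_left (hw0 h) ?_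
  rw [inv_mul_eq_div, one_le_div hm]
  gcongr

variable {E : Type*} [NormedAddCommGroup E] [NormedSpace ℝ E]

/-- The symmetric second difference of a Schwartz function is `O(min 1 ‖h‖²)`, uniformly in the
base point. -/
lemma SchwartzMap.exists_abs_second_difference_le (u : SchwartzMap E ℝ) :
    ∃ C, ∀ x h : E, |2 * u x - u (x + h) - u (x - h)| ≤ C * min 1 (‖h‖ ^ 2) := by
  set v := SchwartzMap.fderivCLM ℝ E ℝ u with hv
  set v' := SchwartzMap.fderivCLM ℝ E (E →L[ℝ] ℝ) v with hv'
  set M := SchwartzMap.seminorm ℝ 0 0 u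
  set B := SchwartzMap.seminorm ℝ 0 0 v'
  have hM (x : E) : |u x| ≤ M := SchwartzMap.norm_le_seminorm ℝ u x
  have hB (x : E) : ‖v' x‖ ≤ B := SchwartzMap.norm_le_seminorm ℝ v' x
  have hM0 : 0 ≤ M := apply_nonneg _ _
  have hB0 : 0 ≤ B := apply_nonneg _ _
  have lip (x y : E) : ‖v y - v x‖ ≤ B * ‖y - x‖ := by
    refine convex_univ.norm_image_sub_le_of_norm_fderiv_le (𝕜 := ℝ) (f := v)
      (fun z _ => v.differentiableAt) (fun z _ => ?_) (mem_univ x) (mem_univ y)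
    simpa [hv', SchwartzMap.fderivCLM_apply] using hB z
  have taylor (x h : E) : |u (x + h) - u x - v x h| ≤ B * ‖h‖ * ‖h‖ := by
    have := (convex_closedBall x ‖h‖).norm_image_sub_le_of_norm_fderiv_le' (𝕜 := ℝ) (f := u)
      (C := B * ‖h‖) (φ := v x) (x := x) (y := x + h)
      (fun z _ => u.differentiableAt) (fun z hz => ?_) (by simp) (by simp)
    · simpa using this
    · have h1 := lip x z
      rw [hv, SchwartzMap.fderivCLM_apply] at h1
      refine h1.trans (mul_le_mul_of_nonneg_left ?_ hB0)
      simpa [dist_eq_norm] using hz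
  refine ⟨4 * M + 2 * B, fun x h => ?_⟩
  have t1 := abs_le.1 (taylor x h)
  have t2 := taylor x (-h)
  rw [norm_neg, map_neg, ← sub_eq_add_neg] at t2
  have t2 := abs_le.1 t2
  have m0 := abs_le.1 (hM x)
  have m1 := abs_le.1 (hM (x + h))
  have m2 := abs_le.1 (hM (x - h))
  rcases min_choice 1 (‖h‖ ^ 2) with hmin | hmin <;> rw [hmin, abs_le]
  · constructor <;> linarith [m0.1, m0.2, m1.1, m1.2, m2.1, m2.2]
  · have : 0 ≤ M * ‖h‖ ^ 2 := by positivity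
    constructor <;> nlinarith [t1.1, t1.2, t2.1, t2.2]

variable [FiniteDimensional ℝ E] [MeasurableSpace E] [BorelSpace E]
  {μ : Measure E} {w : E → ℝ}

/-- The second differences of a Schwartz function are integrable against a Lévy kernel. -/
lemma SchwartzMap.integrable_second_difference_mul (u : SchwartzMap E ℝ) (hwm : Measurable w)
    (hw0 : ∀ h, 0 ≤ w h) (hw : Integrable (fun h => min 1 (‖h‖ ^ 2) * w h) μ) (x : E) :
    Integrable (fun h => (2 * u x - u (x + h) - u (x - h)) * w h) μ := by
  obtain ⟨C, hC⟩ := u.exists_abs_second_difference_le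
  have hum : Measurable u := u.continuous.measurable
  refine (hw.const_mul C).mono' (by fun_prop) (ae_of_all _ fun h => ?_)
  rw [norm_mul, norm_eq_abs, norm_of_nonneg (hw0 h), ← mul_assoc]
  exact mul_le_mul_of_nonneg_right (hC x h) (hw0 h)

variable [μ.IsAddHaarMeasure]

/-- `‖h‖^{-(d+s)}` is a Lévy kernel for `s ∈ (0,2)`. -/
lemma integrable_min_one_norm_sq_mul_rpow [Nontrivial E] {s : ℝ} (hs : s ∈ Ioo (0 : ℝ) 2) :
    Integrable (fun h : E => min 1 (‖h‖ ^ 2) * (1 / ‖h‖ ^ (Module.finrank ℝ E + s))) μ := by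
  rw [integrable_fun_norm_addHaar μ
    (f := fun r : ℝ => min 1 (r ^ 2) * (1 / r ^ (Module.finrank ℝ E + s))),
    ← Ioo_union_Ici_eq_Ioi zero_lt_one, integrableOn_union, integrableOn_Ici_iff_integrableOn_Ioi]
  have hd : 1 ≤ Module.finrank ℝ E := Module.finrank_pos
  have key {r : ℝ} (hr : 0 < r) :
      r ^ (Module.finrank ℝ E - 1) * (1 / r ^ (Module.finrank ℝ E + s)) = r ^ (-1 - s) := by
    rw [one_div, ← rpow_neg hr.le, ← rpow_natCast, ← rpow_add hr, Nat.cast_sub hd]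
    congr 1
    push_cast
    ring
  constructor
  · have := (intervalIntegral.integrableOn_Ioo_rpow_iff (s := 1 - s) zero_lt_one).2
      (by linarith [hs.2])
    refine this.congr_fun (fun r hr => ?_) measurableSet_Ioo
    dsimp only
    have hr0 : 0 < r := hr.1
    rw [min_eq_right (by nlinarith [hr.1, hr.2]), smul_eq_mul, mul_left_comm, key hr0,
      ← rpow_natCast, ← rpow_add hr0]
    congr 1
    push_cast
    ring
  · refine (integrableOn_Ioi_rpow_of_lt (a := -1 - s) (by linarith [hs.1])
      zero_lt_one).congr_fun (fun r hr => ?_) measurableSet_Ioi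
    have hr1 : 1 < r := hr
    dsimp only
    rw [min_eq_left (by nlinarith), smul_eq_mul, one_mul, key (by linarith)]

/-- Symmetrisation of a truncated singular integral. -/
lemma SchwartzMap.setIntegral_sub_mul_eq (u : SchwartzMap E ℝ) (hwm : Measurable w)
    (hw0 : ∀ h, 0 ≤ w h) (hw : Integrable (fun h => min 1 (‖h‖ ^ 2) * w h) μ)
    (hwe : ∀ h, w (-h) = w h) (x : E) {δ : ℝ} (hδ : 0 < δ) :
    ∫ y in {y | δ < ‖y - x‖}, (u x - u y) * w (x - y) ∂μ =
      1 / 2 * ∫ h in {h | δ < ‖h‖}, (2 * u x - u (x + h) - u (x - h)) * w h ∂μ := by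
  have hS : MeasurableSet {h : E | δ < ‖h‖} := measurableSet_lt measurable_const measurable_norm
  have hS' : MeasurableSet {y : E | δ < ‖y - x‖} :=
    measurableSet_lt measurable_const (by fun_prop)
  have hum : Measurable u := u.continuous.measurable
  have hdiff (ε : ℝ) : IntegrableOn (fun h => (u x - u (x + ε • h)) * w h) {h | δ < ‖h‖} μ := by
    refine (integrableOn_of_integrable_min_one_norm_sq_mul hwm hw0 hw hδ).bdd_mul
      (c := 2 * SchwartzMap.seminorm ℝ 0 0 u) (by fun_prop) (ae_of_all _ fun h => ?_)
    have h1 := SchwartzMap.norm_le_seminorm ℝ u x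
    have h2 := SchwartzMap.norm_le_seminorm ℝ u (x + ε • h)
    linarith [norm_sub_le (u x) (u (x + ε • h))]
  have hplus : ∫ y in {y | δ < ‖y - x‖}, (u x - u y) * w (x - y) ∂μ =
      ∫ h in {h | δ < ‖h‖}, (u x - u (x + h)) * w h ∂μ := by
    rw [← integral_indicator hS, ← integral_indicator hS',
      ← integral_add_left_eq_self (μ := μ) _ x]
    congr with h
    simp [indicator, hwe]
  have hminus : ∫ h in {h | δ < ‖h‖}, (u x - u (x + h)) * w h ∂μ =
      ∫ h in {h | δ < ‖h‖}, (u x - u (x - h)) * w h ∂μ := by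
    rw [← integral_indicator hS, ← integral_indicator hS, ← integral_neg_eq_self]
    congr with h
    simp [indicator, hwe, sub_eq_add_neg]
  have hadd : ∫ h in {h | δ < ‖h‖}, (2 * u x - u (x + h) - u (x - h)) * w h ∂μ =
      ∫ h in {h | δ < ‖h‖}, (u x - u (x + h)) * w h ∂μ +
        ∫ h in {h | δ < ‖h‖}, (u x - u (x - h)) * w h ∂μ := by
    rw [← integral_add (by simpa [IntegrableOn] using hdiff 1)
      (by simpa [IntegrableOn, ← sub_eq_add_neg] using hdiff (-1))]
    congr with h
    ring
  rw [hadd, ← hminus, hplus]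
  ring

/-- The principal value of the nonlocal operator with an even Lévy kernel. -/
lemma SchwartzMap.tendsto_setIntegral_sub_mul (u : SchwartzMap E ℝ) (hwm : Measurable w)
    (hw0 : ∀ h, 0 ≤ w h) (hw : Integrable (fun h => min 1 (‖h‖ ^ 2) * w h) μ)
    (hwe : ∀ h, w (-h) = w h) (x : E) :
    Tendsto (fun δ : ℝ => ∫ y in {y | δ < ‖y - x‖}, (u x - u y) * w (x - y) ∂μ) (𝓝[>] (0 : ℝ))
      (𝓝 (1 / 2 * ∫ h, (2 * u x - u (x + h) - u (x - h)) * w h ∂μ)) := by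
  have hD := u.integrable_second_difference_mul hwm hw0 hw x
  have hS (δ : ℝ) : MeasurableSet {h : E | δ < ‖h‖} :=
    measurableSet_lt measurable_const measurable_norm
  have hlim : Tendsto (fun δ : ℝ => 1 / 2 * ∫ h in {h | δ < ‖h‖},
      (2 * u x - u (x + h) - u (x - h)) * w h ∂μ) (𝓝[>] (0 : ℝ))
      (𝓝 (1 / 2 * ∫ h, (2 * u x - u (x + h) - u (x - h)) * w h ∂μ)) := by
    refine Tendsto.const_mul _ ?_
    simp_rw [← integral_indicator (hS _)]
    refine tendsto_integral_filter_of_dominated_convergence _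
      (Eventually.of_forall fun δ => hD.aestronglyMeasurable.indicator (hS δ))
      (Eventually.of_forall fun δ => ae_of_all _ fun h => norm_indicator_le_norm_self _ _)
      hD.norm (ae_of_all _ fun h => ?_)
    rcases eq_or_ne h 0 with rfl | hh
    · simp [indicator, two_mul]
    · refine tendsto_const_nhds.congr' ?_
      filter_upwards [nhdsWithin_le_nhds (Iio_mem_nhds (norm_pos_iff.2 hh))] with δ hδ
      have hmem : h ∈ {h : E | δ < ‖h‖} := hδ
      rw [indicator_of_mem hmem]
  refine hlim.congr' ?_
  filter_upwards [self_mem_nhdsWithin] with δ (hδ : 0 < δ)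
  exact (u.setIntegral_sub_mul_eq hwm hw0 hw hwe x hδ).symm

lemma SchwartzMap.integrable_mul_second_difference_mul_prod (u : SchwartzMap E ℝ)
    (hwm : Measurable w) (hw0 : ∀ h, 0 ≤ w h)
    (hw : Integrable (fun h => min 1 (‖h‖ ^ 2) * w h) μ) :
    Integrable (fun z : E × E => u z.1 * (2 * u z.1 - u (z.1 + z.2) - u (z.1 - z.2)) * w z.2)
      (μ.prod μ) := by
  obtain ⟨C, hC⟩ := u.exists_abs_second_difference_le
  have hum : Measurable u := u.continuous.measurable
  refine ((u.integrable (μ := μ)).norm.mul_prod (hw.const_mul C)).mono' (by fun_prop)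
    (ae_of_all _ fun z => ?_)
  rw [norm_mul, norm_mul, norm_of_nonneg (hw0 _), mul_assoc, ← mul_assoc C]
  gcongr
  · exact hw0 _
  · exact hC z.1 z.2

lemma SchwartzMap.integrable_mul_comp_add (u : SchwartzMap E ℝ) (h : E) :
    Integrable (fun x => u x * u (x + h)) μ := by
  refine u.integrable.mul_bdd (c := SchwartzMap.seminorm ℝ 0 0 u)
    (by fun_prop) (ae_of_all _ fun x => SchwartzMap.norm_le_seminorm ℝ u _)

lemma SchwartzMap.integrable_sub_comp_add_sq (u : SchwartzMap E ℝ) (h : E) :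
    Integrable (fun x => (u x - u (x + h)) ^ 2) μ := by
  have h0 : Integrable (fun x => u x * u x) μ := by simpa using u.integrable_mul_comp_add 0
  convert! (h0.add (h0.comp_add_right h)).sub ((u.integrable_mul_comp_add h).const_mul 2) using 1
  ext x
  simp
  ring

/-- Discrete integration by parts. -/
lemma SchwartzMap.integral_sub_comp_add_sq (u : SchwartzMap E ℝ) (h : E) :
    ∫ x, (u x - u (x + h)) ^ 2 ∂μ = ∫ x, u x * (2 * u x - u (x + h) - u (x - h)) ∂μ := by
  have h0 : Integrable (fun x => u x * u x) μ := by simpa using u.integrable_mul_comp_add 0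
  have h1 := u.integrable_mul_comp_add (μ := μ) h
  have h2 : Integrable (fun x => u x * u (x - h)) μ := by
    simpa [sub_eq_add_neg] using u.integrable_mul_comp_add (μ := μ) (-h)
  have h3 : Integrable (fun x => u x * u x + u (x + h) * u (x + h)) μ :=
    h0.add (h0.comp_add_right h)
  have h4 : Integrable (fun x => 2 * (u x * u x) - u x * u (x + h)) μ := (h0.const_mul 2).sub h1
  have e0 : ∫ x, u (x + h) * u (x + h) ∂μ = ∫ x, u x * u x ∂μ :=
    integral_add_right_eq_self (fun x => u x * u x) h
  have e1 : ∫ x, u x * u (x - h) ∂μ = ∫ x, u x * u (x + h) ∂μ := by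
    rw [← integral_add_right_eq_self _ h]
    simp [mul_comm]
  calc ∫ x, (u x - u (x + h)) ^ 2 ∂μ
      = ∫ x, (u x * u x + u (x + h) * u (x + h) - 2 * (u x * u (x + h))) ∂μ := by
        congr with x
        ring
    _ = ∫ x, (2 * (u x * u x) - u x * u (x + h) - u x * u (x - h)) ∂μ := by
        rw [integral_sub h3 (h1.const_mul 2),
          integral_add h0 (h0.comp_add_right h), integral_sub h4 h2,
          integral_sub (h0.const_mul 2) h1, integral_const_mul, integral_const_mul, e0, e1]
        ring
    _ = _ := by
        congr with x
        ring

/-- The energy form of an even Lévy kernel, expressed through second differences. -/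
lemma SchwartzMap.integral_sub_sq_mul (u : SchwartzMap E ℝ)
    (hwm : Measurable w) (hw0 : ∀ h, 0 ≤ w h)
    (hw : Integrable (fun h => min 1 (‖h‖ ^ 2) * w h) μ) (hwe : ∀ h, w (-h) = w h) :
    ∫ q : E × E, (u q.1 - u q.2) ^ 2 * w (q.1 - q.2) ∂(μ.prod μ) =
      ∫ x, u x * ∫ h, (2 * u x - u (x + h) - u (x - h)) * w h ∂μ ∂μ := by
  have hum : Measurable u := u.continuous.measurable
  have hD := u.integrable_mul_second_difference_mul_prod hwm hw0 hw
  have hinner (h : E) : ∫ x, (u x - u (x + h)) ^ 2 * w h ∂μ =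
      ∫ x, u x * (2 * u x - u (x + h) - u (x - h)) * w h ∂μ := by
    rw [integral_mul_const, integral_mul_const, u.integral_sub_comp_add_sq]
  have hQ : Integrable (fun z : E × E => (u z.1 - u (z.1 + z.2)) ^ 2 * w z.2) (μ.prod μ) := by
    refine (integrable_prod_iff' (by fun_prop)).2
      ⟨ae_of_all _ fun h => (u.integrable_sub_comp_add_sq h).mul_const (w h), ?_⟩
    convert! hD.integral_prod_right using 2 with h
    rw [← hinner]
    congr with x
    exact norm_of_nonneg (mul_nonneg (sq_nonneg _) (hw0 h))
  rw [← (measurePreserving_prod_add μ μ).integral_comp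
    (MeasurableEquiv.shearAddRight E).measurableEmbedding]
  simp only [sub_add_cancel_left, hwe]
  rw [integral_prod_symm _ hQ]
  simp only [hinner]
  rw [← integral_prod_symm _ hD, integral_prod _ hD]
  simp only [mul_assoc, integral_const_mul]

end LevyKernel

/-- Euclidean instance of the identity `[u]²_{H^{s/2}} = 2 ∫ u (-Δ)^{s/2} u`: for a Schwartz
function `u`, the principal value `(-Δ)^{s/2}u(x)` exists at every point, `u·(-Δ)^{s/2}u`
is integrable, and the Gagliardo energy equals twice its integral. -/
theorem seminorm_eq_twice_integral (n : ℕ) (hn : 1 ≤ n) (s : ℝ) (hs : s ∈ Ioo (0:ℝ) 2)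
    (u : SchwartzMap (EuclideanSpace ℝ (Fin n)) ℝ) :
    ∃ L : EuclideanSpace ℝ (Fin n) → ℝ,
      (∀ x : EuclideanSpace ℝ (Fin n),
        Tendsto
          (fun δ : ℝ => ∫ y in {y : EuclideanSpace ℝ (Fin n) | δ < ‖y - x‖},
            (u x - u y) * (alphaConst n s / ‖x - y‖ ^ ((n : ℝ) + s)))
          (𝓝[>] (0:ℝ)) (𝓝 (L x))) ∧
      Integrable (fun x => u x * L x) ∧
      ∫ q : EuclideanSpace ℝ (Fin n) × EuclideanSpace ℝ (Fin n),
          alphaConst n s * (u q.1 - u q.2) ^ 2 / ‖q.1 - q.2‖ ^ ((n : ℝ) + s) =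
        2 * ∫ x, u x * L x := by
  have : Nonempty (Fin n) := ⟨⟨0, hn⟩⟩
  set c := alphaConst n s
  set w : EuclideanSpace ℝ (Fin n) → ℝ := fun h => 1 / ‖h‖ ^ ((n : ℝ) + s)
  have hwm : Measurable w := by fun_prop
  have hw0 (h) : 0 ≤ w h := by positivity
  have hwe (h) : w (-h) = w h := by simp [w]
  have hw : Integrable (fun h => min 1 (‖h‖ ^ 2) * w h) := by
    simpa [w] using integrable_min_one_norm_sq_mul_rpow
      (E := EuclideanSpace ℝ (Fin n)) (μ := volume) hs
  refine ⟨fun x => c * (1 / 2 * ∫ h, (2 * u x - u (x + h) - u (x - h)) * w h),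
    fun x => ?_, ?_, ?_⟩
  · convert! (u.tendsto_setIntegral_sub_mul hwm hw0 hw hwe x).const_mul c using 2 with δ
    rw [← integral_const_mul]
    congr with y
    simp only [w]
    ring
  · convert! (u.integrable_mul_second_difference_mul_prod hwm hw0 hw).integral_prod_left.const_mul
      (c / 2) using 2 with x
    simp only [mul_assoc, integral_const_mul]
    ring
  · have key := u.integral_sub_sq_mul hwm hw0 hw hwe
    calc _ = ∫ q : EuclideanSpace ℝ (Fin n) × EuclideanSpace ℝ (Fin n),
          c * ((u q.1 - u q.2) ^ 2 * w (q.1 - q.2)) := by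
          congr with q
          simp only [w]
          ring
      _ = c * ∫ x, u x * ∫ h, (2 * u x - u (x + h) - u (x - h)) * w h := by
          rw [integral_const_mul, ← key]
          rfl
      _ = _ := by
          rw [← integral_const_mul, ← integral_const_mul]
          congr with x
          ring
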